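/- arXiv:2407.04857 — 2 statements merged into one kernel-verified Lean document; each statement's English description precedes it below -/
import Mathlib

section
/- Suppose the correspondence Σ^Φ_{T−1} assigning to each length-(T−1) economy its set of Φ-solutions is nonempty-valued. Fix a length-T economy E^T and a candidate matching m* ∈ M*(φ_1, Σ^Φ_{T−1}). If for every period-1 agent k ∈ A_1∪B_1 with m*_1(k) = k one has m* ∈ φ_1(∅,k), then m* is a Φ-solution of E^T, i.e., m* ∈ Σ^Φ_T(E^T). -/
/-!
A framework for two-sided, one-to-one, irreversible dynamic matching markets
with conjectures, following Doval's "A framework for (dynamic) stability".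

Periods are indexed `0, …, T-1` (the paper's periods `1, …, T`).
-/

namespace DynMatch

open Classical

noncomputable section

/-- A length-`T` two-sided dynamic economy: the arrivals on each side in each period. -/
structure Economy (A B : Type) where
  T : ℕ
  arrA : ℕ → Finset A
  arrB : ℕ → Finset B

/-- Validity of an economy: positive length, pairwise disjoint arrivals, and
no arrivals outside the horizon. -/
def Economy.Valid {A B : Type} (E : Economy A B) : Prop :=
  0 < E.T ∧
  (∀ s t, s ≠ t → Disjoint (E.arrA s) (E.arrA t)) ∧
  (∀ s t, s ≠ t → Disjoint (E.arrB s) (E.arrB t)) ∧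
  (∀ s, E.T ≤ s → E.arrA s = ∅) ∧ (∀ s, E.T ≤ s → E.arrB s = ∅)

/-- A raw dynamic matching: in every period, a partial pairing between the two sides
(`none` means unmatched, i.e. matched to oneself). -/
structure PreMatching (A B : Type) where
  mA : ℕ → A → Option B
  mB : ℕ → B → Option A

variable {A B : Type} [DecidableEq A] [DecidableEq B]

/-- Side-`A` agents having arrived up to (and including) period `t`. -/
def arrAUpTo (E : Economy A B) (t : ℕ) : Finset A := (Finset.range (t+1)).biUnion E.arrA

/-- Side-`B` agents having arrived up to (and including) period `t`. -/
def arrBUpTo (E : Economy A B) (t : ℕ) : Finset B := (Finset.range (t+1)).biUnion E.arrB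

/-- `m` is an irreversible dynamic matching for the economy `E`: in every period it is
an involutive pairing between arrived agents of the two sides, and once matched a
pair stays matched. -/
def IsMatching (E : Economy A B) (m : PreMatching A B) : Prop :=
  (∀ t a b, t < E.T → (m.mA t a = some b ↔ m.mB t b = some a)) ∧
  (∀ t a, t < E.T → m.mA t a ≠ none → a ∈ arrAUpTo E t) ∧
  (∀ t a b, t < E.T → m.mA t a = some b → b ∈ arrBUpTo E t) ∧
  (∀ t s a, t ≤ s → s < E.T → m.mA t a ≠ none → m.mA s a = m.mA t a) ∧
  (∀ t s b, t ≤ s → s < E.T → m.mB t b ≠ none → m.mB s b = m.mB t b)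

/-- The everywhere-unmatched prematching. -/
def emptyM : PreMatching A B := ⟨fun _ _ => none, fun _ _ => none⟩

/-- An agent of the economy: a side-`A` or a side-`B` agent. -/
abbrev Agent (A B : Type) := A ⊕ B

/-- `𝒜_t(m^{t-1})`: side-`A` agents available to match in period `t` given history `m`. -/
def availA (E : Economy A B) (m : PreMatching A B) (t : ℕ) : Finset A :=
  (arrAUpTo E t).filter fun a => ∀ s, s < t → m.mA s a = none

/-- `ℬ_t(m^{t-1})`: side-`B` agents available to match in period `t` given history `m`. -/
def availB (E : Economy A B) (m : PreMatching A B) (t : ℕ) : Finset B :=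
  (arrBUpTo E t).filter fun b => ∀ s, s < t → m.mB s b = none

/-- `k ∈ 𝒜_t(m^{t-1}) ∪ ℬ_t(m^{t-1})`. -/
def isAvail (E : Economy A B) (m : PreMatching A B) (t : ℕ) : Agent A B → Prop
  | Sum.inl a => a ∈ availA E m t
  | Sum.inr b => b ∈ availB E m t

/-- `k ∈ A_1 ∪ B_1`: `k` is a first-period arrival. -/
def inPeriodOne (E : Economy A B) : Agent A B → Prop
  | Sum.inl a => a ∈ E.arrA 0
  | Sum.inr b => b ∈ E.arrB 0

/-- `m_t(k) = k`: agent `k` is unmatched in period `t` under `m`. -/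
def unmatchedAt (m : PreMatching A B) (t : ℕ) : Agent A B → Prop
  | Sum.inl a => m.mA t a = none
  | Sum.inr b => m.mB t b = none

/-- `m` and `m'` agree in all periods `s < t` (i.e. they share the history `m^{t-1}`). -/
def agreeUpTo (m m' : PreMatching A B) (t : ℕ) : Prop :=
  ∀ s, s < t → (∀ a, m.mA s a = m'.mA s a) ∧ (∀ b, m.mB s b = m'.mB s b)

/-- Agent `k` is unmatched through period `t` (all periods `s ≤ t`) under `m`. -/
def unmatchedThrough (m : PreMatching A B) (t : ℕ) : Agent A B → Prop
  | Sum.inl a => ∀ s, s ≤ t → m.mA s a = none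
  | Sum.inr b => ∀ s, s ≤ t → m.mB s b = none

/-- `M_T(m^{t-1})`: matchings of `E` agreeing with `m` through period `t-1`. -/
def MSetH (E : Economy A B) (m : PreMatching A B) (t : ℕ) : Set (PreMatching A B) :=
  {m' | IsMatching E m' ∧ agreeUpTo m m' t}

/-- `M_T(m^{t-1}, k)`: matchings of `E` agreeing with `m` through period `t-1` and
leaving `k` unmatched through period `t`. -/
def MSet (E : Economy A B) (m : PreMatching A B) (t : ℕ) (k : Agent A B) :
    Set (PreMatching A B) :=
  {m' | IsMatching E m' ∧ agreeUpTo m m' t ∧ unmatchedThrough m' t k}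

/-- Preferences: Bernoulli utilities on both sides and discount factors.
(The payoff of remaining single is normalized to `0`.) -/
structure Pref (A B : Type) where
  u : A → B → ℝ
  v : A → B → ℝ
  dA : A → ℝ
  dB : B → ℝ

/-- Discount factors lie in `[0,1]`. -/
def Pref.Valid (P : Pref A B) : Prop :=
  (∀ a, 0 ≤ P.dA a ∧ P.dA a ≤ 1) ∧ (∀ b, 0 ≤ P.dB b ∧ P.dB b ≤ 1)

/-- `t_m(a)`: the first period `s ≥ t` at which `a` is matched under `m` (`T` if never). -/
def matchTimeA (E : Economy A B) (m : PreMatching A B) (t : ℕ) (a : A) : ℕ :=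
  min (sInf {s | t ≤ s ∧ m.mA s a ≠ none}) E.T

/-- `t_m(b)`: the first period `s ≥ t` at which `b` is matched under `m` (`T` if never). -/
def matchTimeB (E : Economy A B) (m : PreMatching A B) (t : ℕ) (b : B) : ℕ :=
  min (sInf {s | t ≤ s ∧ m.mB s b ≠ none}) E.T

/-- `U_t(a,m) = δ_a^{t_m(a)-t}·u(a, m_T(a))` (and `0` if `a` ends up unmatched). -/
def Upay (P : Pref A B) (E : Economy A B) (m : PreMatching A B) (t : ℕ) (a : A) : ℝ :=
  match m.mA (E.T - 1) a with
  | none => 0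
  | some b => P.dA a ^ (matchTimeA E m t a - t) * P.u a b

/-- `V_t(b,m) = δ_b^{t_m(b)-t}·v(m_T(b), b)` (and `0` if `b` ends up unmatched). -/
def Vpay (P : Pref A B) (E : Economy A B) (m : PreMatching A B) (t : ℕ) (b : B) : ℝ :=
  match m.mB (E.T - 1) b with
  | none => 0
  | some a => P.dB b ^ (matchTimeB E m t b - t) * P.v a b

/-- A family of conjectures `Φ`: for every period `t`, history `m^{t-1}` and agent `k`,
a set `φ_t(m^{t-1},k)` of matchings `k` considers possible upon remaining unmatched. -/
abbrev ConjFam (A B : Type) := ℕ → PreMatching A B → Agent A B → Set (PreMatching A B)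

/-- Validity of a family of conjectures for `E`: conjectures are (nonempty) subsets of
`M_T(m^{t-1},k)` and depend on the matching only through the history `m^{t-1}`. -/
def ConjFam.Valid (E : Economy A B) (φ : ConjFam A B) : Prop :=
  (∀ t m k, φ t m k ⊆ MSet E m t k) ∧
  (∀ t m m' k, agreeUpTo m m' t → φ t m k = φ t m' k) ∧
  (∀ t m k, t < E.T → IsMatching E m → isAvail E m t k → (φ t m k).Nonempty)

/-- `m` is a `Φ`-solution for `E` (Definition 3): in every period, every available agent
weakly prefers `m` to some conjectured matching, and no available pair blocks. -/
def IsSolution (P : Pref A B) (E : Economy A B) (φ : ConjFam A B)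
    (m : PreMatching A B) : Prop :=
  IsMatching E m ∧
  ∀ t, t < E.T →
    ((∀ a ∈ availA E m t, ∃ m' ∈ φ t m (Sum.inl a), Upay P E m' t a ≤ Upay P E m t a) ∧
     (∀ b ∈ availB E m t, ∃ m' ∈ φ t m (Sum.inr b), Vpay P E m' t b ≤ Vpay P E m t b) ∧
     (∀ a ∈ availA E m t, ∀ b ∈ availB E m t,
        ¬(P.u a b > Upay P E m t a ∧ P.v a b > Vpay P E m t b)))

/-- `Σ^Φ_T(E)`: the set of `Φ`-solutions of `E`. -/
def SolSet (P : Pref A B) (E : Economy A B) (φ : ConjFam A B) : Set (PreMatching A B) :=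
  {m | IsSolution P E φ m}

/-- The static (Gale–Shapley) notion of stability, for length-1 economies:
individual rationality plus absence of blocking pairs. -/
def Stable1 (P : Pref A B) (E : Economy A B) (m : PreMatching A B) : Prop :=
  IsMatching E m ∧
  (∀ a b, m.mA (E.T - 1) a = some b → 0 ≤ P.u a b) ∧
  (∀ b a, m.mB (E.T - 1) b = some a → 0 ≤ P.v a b) ∧
  (∀ a ∈ E.arrA 0, ∀ b ∈ E.arrB 0,
     ¬(P.u a b > Upay P E m 0 a ∧ P.v a b > Vpay P E m 0 b))

/-- The worst (minimal) period-`t` payoff of `a` over the set `C (inl a)` of matchings. -/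
def wA (P : Pref A B) (E : Economy A B) (t : ℕ)
    (C : Agent A B → Set (PreMatching A B)) (a : A) : ℝ :=
  sInf ((fun m' => Upay P E m' t a) '' C (Sum.inl a))

/-- The worst (minimal) period-`t` payoff of `b` over the set `C (inr b)` of matchings. -/
def wB (P : Pref A B) (E : Economy A B) (t : ℕ)
    (C : Agent A B → Set (PreMatching A B)) (b : B) : ℝ :=
  sInf ((fun m' => Vpay P E m' t b) '' C (Sum.inr b))

/-- Utility of side-`A` agent `a` in the induced one-period economy with outside
option value `W a` (truncated preferences). -/
def indU (P : Pref A B) (W : A → ℝ) (a : A) : Option B → ℝ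
  | none => W a
  | some b => P.u a b

/-- Utility of side-`B` agent `b` in the induced one-period economy with outside
option value `W b` (truncated preferences). -/
def indV (P : Pref A B) (W : B → ℝ) (b : B) : Option A → ℝ
  | none => W b
  | some a => P.v a b

/-- The period-`t` component of `mbar` is a stable matching of the one-period economy
`E_{t,φ}(m^{t-1})` induced by the conjecture profile `C` (Definition 6): matching among
the available agents, individually rational w.r.t. the worst-conjecture thresholds,
and without blocking pairs in the truncated preferences. -/
def StableInduced (P : Pref A B) (E : Economy A B) (m : PreMatching A B) (t : ℕ)
    (C : Agent A B → Set (PreMatching A B)) (mbar : PreMatching A B) : Prop :=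
  (∀ a ∈ availA E m t, ∀ b, mbar.mA t a = some b → b ∈ availB E m t ∧ mbar.mB t b = some a) ∧
  (∀ b ∈ availB E m t, ∀ a, mbar.mB t b = some a → a ∈ availA E m t ∧ mbar.mA t a = some b) ∧
  (∀ a ∈ availA E m t, ∀ b, mbar.mA t a = some b → wA P E t C a ≤ P.u a b) ∧
  (∀ b ∈ availB E m t, ∀ a, mbar.mB t b = some a → wB P E t C b ≤ P.v a b) ∧
  (∀ a ∈ availA E m t, ∀ b ∈ availB E m t,
     ¬(P.u a b > indU P (wA P E t C) a (mbar.mA t a) ∧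
       P.v a b > indV P (wB P E t C) b (mbar.mB t b)))

/-- `mbar_t` is stable among those who match in period `t` relative to the conjecture
profile `C` (Definition 7): every available agent matched in period `t` weakly prefers
its partner to its worst conjectured matching, and no pair of agents both matched in
period `t` blocks. -/
def StableAmongMatched (P : Pref A B) (E : Economy A B) (m : PreMatching A B) (t : ℕ)
    (C : Agent A B → Set (PreMatching A B)) (mbar : PreMatching A B) : Prop :=
  (∀ a ∈ availA E m t, ∀ b, mbar.mA t a = some b → wA P E t C a ≤ P.u a b) ∧
  (∀ b ∈ availB E m t, ∀ a, mbar.mB t b = some a → wB P E t C b ≤ P.v a b) ∧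
  (∀ a ∈ availA E m t, ∀ b ∈ availB E m t, ∀ b' a',
     mbar.mA t a = some b' → mbar.mB t b = some a' →
     ¬(P.u a b > P.u a b' ∧ P.v a b > P.v a' b))

/-- `E_t^T(m^{t-1})`: the continuation economy starting at period `t` given history `m`:
its first-period arrivals are the agents available at `t`, later arrivals are unchanged. -/
def contEconomy (E : Economy A B) (m : PreMatching A B) (t : ℕ) : Economy A B where
  T := E.T - t
  arrA := fun s => if s = 0 then availA E m t else E.arrA (t + s)
  arrB := fun s => if s = 0 then availB E m t else E.arrB (t + s)

/-- The restriction of `m` to the continuation economy starting in period `t`: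
time is shifted by `t` and agents matched strictly before `t` are dropped. -/
def restrictM (m : PreMatching A B) (t : ℕ) : PreMatching A B where
  mA := fun s a => if ∀ s', s' < t → m.mA s' a = none then m.mA (t + s) a else none
  mB := fun s b => if ∀ s', s' < t → m.mB s' b = none then m.mB (t + s) b else none

/-- The matching of the original economy corresponding to history `m` through period
`t-1` followed by the continuation matching `m'` (indexed from `0`) of the
continuation economy. -/
def splice (m m' : PreMatching A B) (t : ℕ) : PreMatching A B where
  mA := fun s a => if s < t then m.mA s a
    else if ∀ s', s' < t → m.mA s' a = none then m'.mA (s - t) a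
    else m.mA (t - 1) a
  mB := fun s b => if s < t then m.mB s b
    else if ∀ s', s' < t → m.mB s' b = none then m'.mB (s - t) b
    else m.mB (t - 1) b

/-- The family of conjectures that the family `φ` of the original economy induces on the
continuation economy `E_t^T(m^{t-1})`: at a continuation history, it is the (restriction
of the) original conjectures at the corresponding original history. -/
def contConj (E : Economy A B) (φ : ConjFam A B) (m : PreMatching A B) (t : ℕ) :
    ConjFam A B :=
  fun s mbar k => (fun m' => restrictM m' t) '' φ (t + s) (splice m mbar t) k

/-- The conjectures of eq. (2): the agent only rules out continuation matchings that do
not conform with the solution concept `S` from tomorrow onward. -/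
def starConj (S : Economy A B → Set (PreMatching A B)) (E : Economy A B) : ConjFam A B :=
  fun t m k =>
    {m' | m' ∈ MSet E m t k ∧ restrictM m' (t+1) ∈ S (contEconomy E m' (t+1))}

/-- `S` is the solution correspondence `Σ*` recursively generated by the conjectures of
eq. (2): stability for one-period economies, `Φ*`-solutions for longer economies
(empty continuations impose no restriction). -/
def IsStarFamily (P : Pref A B) (S : Economy A B → Set (PreMatching A B)) : Prop :=
  (∀ E : Economy A B, E.T = 0 → S E = Set.univ) ∧
  (∀ E : Economy A B, E.T = 1 → S E = {m | Stable1 P E m}) ∧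
  (∀ E : Economy A B, 2 ≤ E.T → S E = SolSet P E (starConj S E))

/-- The decreasing recursion defining the CVR conjectures at period `t`, history `m`,
relative to the continuation solution correspondence `DS`. -/
def cvrIter (P : Pref A B) (E : Economy A B)
    (DS : Economy A B → Set (PreMatching A B)) (t : ℕ) (m : PreMatching A B) :
    ℕ → Agent A B → Set (PreMatching A B)
  | 0 => fun k => MSet E m t k
  | n+1 => fun k =>
      {mbar | mbar ∈ MSet E m t k ∧
        StableAmongMatched P E m t (cvrIter P E DS t m n) mbar ∧
        restrictM mbar (t+1) ∈ DS (contEconomy E mbar (t+1))}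

/-- The CVR conjectures `φ_{D̂S,t}(m^{t-1},·)`: the limit (intersection) of the
decreasing recursion `cvrIter`. -/
def cvrConj (P : Pref A B) (DS : Economy A B → Set (PreMatching A B))
    (E : Economy A B) : ConjFam A B :=
  fun t m k => ⋂ n, cvrIter P E DS t m n k

/-- `DS` is the CVR-dynamic-stability correspondence `D̂S`: stable matchings for
one-period economies, `Φ_{D̂S}`-solutions for longer economies. -/
def IsCVRFamily (P : Pref A B) (DS : Economy A B → Set (PreMatching A B)) : Prop :=
  (∀ E : Economy A B, E.T = 0 → DS E = Set.univ) ∧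
  (∀ E : Economy A B, E.T = 1 → DS E = {m | Stable1 P E m}) ∧
  (∀ E : Economy A B, 2 ≤ E.T → DS E = SolSet P E (cvrConj P DS E))

/-- The dynamic-stability conjectures of Doval (2022): the period-`t` matching is stable
among those who match relative to individually rational continuation values, and the
continuation is dynamically stable. -/
def dsConj (P : Pref A B) (DSol : Economy A B → Set (PreMatching A B))
    (E : Economy A B) : ConjFam A B :=
  fun t m k =>
    {mbar | mbar ∈ MSet E m t k ∧
      (∀ a ∈ availA E m t, ∀ b, mbar.mA t a = some b → 0 ≤ P.u a b) ∧
      (∀ b ∈ availB E m t, ∀ a, mbar.mB t b = some a → 0 ≤ P.v a b) ∧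
      (∀ a ∈ availA E m t, ∀ b ∈ availB E m t, ∀ b' a',
         mbar.mA t a = some b' → mbar.mB t b = some a' →
         ¬(P.u a b > P.u a b' ∧ P.v a b > P.v a' b)) ∧
      restrictM mbar (t+1) ∈ DSol (contEconomy E mbar (t+1))}

/-- `DSol` is the dynamic-stability correspondence `DS` of Doval (2022). -/
def IsDSFamily (P : Pref A B) (DSol : Economy A B → Set (PreMatching A B)) : Prop :=
  (∀ E : Economy A B, E.T = 0 → DSol E = Set.univ) ∧
  (∀ E : Economy A B, E.T = 1 → DSol E = {m | Stable1 P E m}) ∧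
  (∀ E : Economy A B, 2 ≤ E.T → DSol E = SolSet P E (dsConj P DSol E))

/-- `E_{\k}`: the economy identical to `E` except that agent `k`'s arrival is delayed
by one period (from period `0` to period `1`). -/
def delayEconomy (E : Economy A B) : Agent A B → Economy A B
  | Sum.inl a =>
      { T := E.T
        arrA := fun s => if s = 0 then E.arrA 0 \ {a}
                 else if s = 1 then insert a (E.arrA 1) else E.arrA s
        arrB := E.arrB }
  | Sum.inr b =>
      { T := E.T
        arrA := E.arrA
        arrB := fun s => if s = 0 then E.arrB 0 \ {b}
                 else if s = 1 then insert b (E.arrB 1) else E.arrB s }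

/-- The candidate set `M*(m^{t-1}, C, Scont)`: matchings whose period-`t` matching is
stable in the one-period economy induced by the continuation-value sets `C`, and whose
continuation lies in `Scont` of the induced continuation economy. -/
def candT (P : Pref A B) (Scont : Economy A B → Set (PreMatching A B))
    (E : Economy A B) (t : ℕ) (m : PreMatching A B)
    (C : Agent A B → Set (PreMatching A B)) : Set (PreMatching A B) :=
  {mbar | mbar ∈ MSetH E m t ∧ StableInduced P E m t C mbar ∧
    restrictM mbar (t+1) ∈ Scont (contEconomy E mbar (t+1))}

/-- The increasing recursion `F_n` defining the sophisticated-dynamic-stability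
conjectures at period `t`, history `m`, relative to the correspondence `SDS` on
strictly shorter problems. -/
def sdsF (P : Pref A B) (SDS : Economy A B → Set (PreMatching A B))
    (E : Economy A B) (t : ℕ) (m : PreMatching A B) :
    ℕ → Agent A B → Set (PreMatching A B)
  | 0 => fun k =>
      {mbar | mbar ∈ MSet E m t k ∧
        restrictM mbar t ∈ SDS (delayEconomy (contEconomy E m t) k)}
  | n+1 => fun k => sdsF P SDS E t m n k ∪
      {mbar | mbar ∈ candT P SDS E t m (sdsF P SDS E t m n) ∧ unmatchedAt mbar t k}

/-- The SDS conjectures `φ_{SDS,t}`: the limit (union) of the increasing recursion `F_n`. -/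
def sdsConj (P : Pref A B) (SDS : Economy A B → Set (PreMatching A B))
    (E : Economy A B) : ConjFam A B :=
  fun t m k => ⋃ n, sdsF P SDS E t m n k

/-- `SDS` is the sophisticated-dynamic-stability correspondence. -/
def IsSDSFamily (P : Pref A B) (SDS : Economy A B → Set (PreMatching A B)) : Prop :=
  (∀ E : Economy A B, E.T = 0 → SDS E = Set.univ) ∧
  (∀ E : Economy A B, E.T = 1 → SDS E = {m | Stable1 P E m}) ∧
  (∀ E : Economy A B, 2 ≤ E.T → SDS E = SolSet P E (sdsConj P SDS E))

/-- The rational-expectations conjectures: `k` conjectures exactly the `RE` solutions of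
the continuation economy in which `k`'s arrival is delayed by one period. -/
def reConj (RE : Economy A B → Set (PreMatching A B)) (E : Economy A B) : ConjFam A B :=
  fun t m k =>
    {mbar | mbar ∈ MSet E m t k ∧
      restrictM mbar t ∈ RE (delayEconomy (contEconomy E m t) k)}

/-- `RE` is the rational-expectations solution correspondence. -/
def IsREFamily (P : Pref A B) (RE : Economy A B → Set (PreMatching A B)) : Prop :=
  (∀ E : Economy A B, E.T = 1 → RE E = {m | Stable1 P E m}) ∧
  (∀ E : Economy A B, 2 ≤ E.T → RE E = SolSet P E (reConj RE E))


/-! ### Exchanging the two sides of the market -/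

/-- The economy with the roles of the two sides exchanged. -/
def Economy.swap (E : Economy A B) : Economy B A := ⟨E.T, E.arrB, E.arrA⟩

/-- The matching with the roles of the two sides exchanged. -/
def PreMatching.swap (m : PreMatching A B) : PreMatching B A := ⟨m.mB, m.mA⟩

/-- The preferences with the roles of the two sides exchanged. -/
def Pref.swap (P : Pref A B) : Pref B A :=
  ⟨fun b a => P.v a b, fun b a => P.u a b, P.dB, P.dA⟩

theorem IsMatching.swap {E : Economy A B} {m : PreMatching A B} (h : IsMatching E m) :
    IsMatching E.swap m.swap := by
  obtain ⟨hinv, hA, hB, hirrA, hirrB⟩ := h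
  refine ⟨fun t b a ht => (hinv t a b ht).symm, fun t b ht hb => ?_, fun t b a ht hb => ?_,
    hirrB, hirrA⟩
  · obtain ⟨a, ha⟩ := Option.ne_none_iff_exists'.mp hb
    exact hB t a b ht ((hinv t a b ht).2 ha)
  · have hab : m.mA t a = some b := (hinv t a b ht).2 hb
    exact hA t a ht (by simp [hab])

/-! ### Payoffs -/

theorem Upay_zero_of_matched (P : Pref A B) {E : Economy A B} {m : PreMatching A B}
    (hT : 1 ≤ E.T) (hm : IsMatching E m) {a : A} {b : B} (h : m.mA 0 a = some b) :
    Upay P E m 0 a = P.u a b := by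
  have hlast : m.mA (E.T - 1) a = some b := by
    rw [hm.2.2.2.1 0 (E.T - 1) a (Nat.zero_le _) (by omega) (by simp [h]), h]
  have hinf : sInf {s | 0 ≤ s ∧ m.mA s a ≠ none} = 0 :=
    Nat.sInf_eq_zero.2 (Or.inl ⟨le_rfl, by simp [h]⟩)
  have htime : matchTimeA E m 0 a = 0 := by rw [matchTimeA, hinf, Nat.zero_min]
  simp [Upay, hlast, htime]

theorem Vpay_zero_of_matched (P : Pref A B) {E : Economy A B} {m : PreMatching A B}
    (hT : 1 ≤ E.T) (hm : IsMatching E m) {a : A} {b : B} (h : m.mB 0 b = some a) :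
    Vpay P E m 0 b = P.v a b :=
  Upay_zero_of_matched P.swap (E := E.swap) hT hm.swap h

/-- Only finitely many payoffs are attainable by a given agent across all matchings. -/
theorem finite_Upay_image (P : Pref A B) (E : Economy A B) (hT : 1 ≤ E.T) (t : ℕ) (a : A) :
    ((fun m => Upay P E m t a) '' {m | IsMatching E m}).Finite := by
  refine (((Set.finite_Iic E.T).image2 (fun n b => P.dA a ^ n * P.u a b)
    (arrBUpTo E (E.T - 1)).finite_toSet).insert 0).subset ?_
  rintro _ ⟨m, hm, rfl⟩
  rcases h : m.mA (E.T - 1) a with _ | b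
  · exact Or.inl (by simp [Upay, h])
  · refine Or.inr ⟨matchTimeA E m t a - t, ?_, b, hm.2.2.1 _ a b (by omega) h, ?_⟩
    · exact (Nat.sub_le _ _).trans (min_le_right _ _)
    · simp [Upay, h]

theorem finite_Vpay_image (P : Pref A B) (E : Economy A B) (hT : 1 ≤ E.T) (t : ℕ) (b : B) :
    ((fun m => Vpay P E m t b) '' {m | IsMatching E m}).Finite := by
  refine (finite_Upay_image P.swap E.swap hT t b).subset ?_
  rintro _ ⟨m, hm, rfl⟩
  exact ⟨m.swap, hm.swap, rfl⟩

/-- Payoffs in the continuation economy are payoffs in the original economy, for agents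
still unmatched after the first period. -/
theorem Upay_restrictM (P : Pref A B) (E : Economy A B) (m₀ m : PreMatching A B) {s : ℕ}
    (hs : 1 + s < E.T) {a : A} (h : m.mA 0 a = none) :
    Upay P (contEconomy E m₀ 1) (restrictM m 1) s a = Upay P E m (1 + s) a := by
  have hlast : 1 + (E.T - 1 - 1) = E.T - 1 := by omega
  have hres : ∀ r, (restrictM m 1).mA r a = m.mA (1 + r) a := by simp [restrictM, h]
  have hcont : (contEconomy E m₀ 1).T = E.T - 1 := rfl
  rcases hb : m.mA (E.T - 1) a with _ | b
  · simp [Upay, hcont, hres, hlast, hb]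
  · have hne : {r | 1 + s ≤ r ∧ m.mA r a ≠ none}.Nonempty :=
      ⟨E.T - 1, by omega, by simp [hb]⟩
    have hpos : 1 ≤ sInf {r | 1 + s ≤ r ∧ m.mA r a ≠ none} := by
      have := (Nat.sInf_mem hne).1
      omega
    have hshift := Nat.sInf_add hpos
    have hset : {r | s ≤ r ∧ (restrictM m 1).mA r a ≠ none} =
        {r | 1 + s ≤ r + 1 ∧ m.mA (r + 1) a ≠ none} := by
      ext r
      simp only [Set.mem_ofPred_eq, hres, add_comm 1, add_le_add_iff_right]
    have htime : matchTimeA (contEconomy E m₀ 1) (restrictM m 1) s a - s =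
        matchTimeA E m (1 + s) a - (1 + s) := by
      simp only [matchTimeA, hcont, hset]
      omega
    simp [Upay, hcont, hres, hlast, hb, htime]

theorem Vpay_restrictM (P : Pref A B) (E : Economy A B) (m₀ m : PreMatching A B) {s : ℕ}
    (hs : 1 + s < E.T) {b : B} (h : m.mB 0 b = none) :
    Vpay P (contEconomy E m₀ 1) (restrictM m 1) s b = Vpay P E m (1 + s) b :=
  Upay_restrictM P.swap E.swap m₀.swap m.swap hs h

/-! ### The continuation economy -/

theorem mem_availA_contEconomy {E : Economy A B} {m : PreMatching A B} {s : ℕ} {a : A}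
    (ha : a ∈ availA E m (1 + s)) :
    a ∈ availA (contEconomy E m 1) (restrictM m 1) s := by
  simp only [availA, Finset.mem_filter, arrAUpTo, Finset.mem_biUnion, Finset.mem_range] at ha ⊢
  obtain ⟨⟨r, hr, har⟩, hun⟩ := ha
  refine ⟨?_, fun r' hr' => ?_⟩
  · by_cases h1 : r ≤ 1
    · refine ⟨0, by omega, ?_⟩
      simp only [contEconomy, if_true, availA, Finset.mem_filter, arrAUpTo, Finset.mem_biUnion,
        Finset.mem_range]
      exact ⟨⟨r, by omega, har⟩, fun r' hr' => hun r' (by omega)⟩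
    · refine ⟨r - 1, by omega, ?_⟩
      have h0 : r - 1 ≠ 0 := by omega
      have h2 : 1 + (r - 1) = r := by omega
      simpa [contEconomy, h0, h2] using har
  · simp [restrictM, hun (1 + r') (by omega)]

theorem mem_availB_contEconomy {E : Economy A B} {m : PreMatching A B} {s : ℕ} {b : B}
    (hb : b ∈ availB E m (1 + s)) :
    b ∈ availB (contEconomy E m 1) (restrictM m 1) s :=
  mem_availA_contEconomy (E := E.swap) (m := m.swap) hb

/-- Splicing a matching with its own restriction recovers the matching. -/
theorem agreeUpTo_splice_restrictM {E : Economy A B} {m : PreMatching A B}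
    (hm : IsMatching E m) {t : ℕ} (ht : t ≤ E.T) :
    agreeUpTo (splice m (restrictM m 1) 1) m t := by
  intro s hs
  rcases Nat.eq_zero_or_pos s with rfl | hpos
  · simp [splice]
  have hsub : 1 + (s - 1) = s := by omega
  have h0 : s ≠ 0 := hpos.ne'
  constructor
  · intro a
    by_cases h : m.mA 0 a = none
    · simp [splice, restrictM, h, hsub, h0]
    · simp [splice, h, h0, hm.2.2.2.1 0 s a (Nat.zero_le _) (by omega) h]
  · intro b
    by_cases h : m.mB 0 b = none
    · simp [splice, restrictM, h, hsub, h0]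
    · simp [splice, h, h0, hm.2.2.2.2 0 s b (Nat.zero_le _) (by omega) h]

/-! ### The first period -/

/-- If an agent's conjectures contain `m` whenever `m` leaves the agent unmatched in the first
period, then the agent's payoff under `m` is at least its value in the induced one-period
economy. -/
theorem indU_le_Upay (P : Pref A B) {E : Economy A B} {m : PreMatching A B} (hT : 1 ≤ E.T)
    (hm : IsMatching E m) {C : Agent A B → Set (PreMatching A B)} {a : A}
    (hC : C (Sum.inl a) ⊆ {m | IsMatching E m})
    (hmem : m.mA 0 a = none → m ∈ C (Sum.inl a)) :
    indU P (wA P E 0 C) a (m.mA 0 a) ≤ Upay P E m 0 a := by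
  rcases h : m.mA 0 a with _ | b
  · exact csInf_le ((finite_Upay_image P E hT 0 a).subset (Set.image_mono hC)).bddBelow
      ⟨m, hmem h, rfl⟩
  · exact (Upay_zero_of_matched P hT hm h).ge

theorem indV_le_Vpay (P : Pref A B) {E : Economy A B} {m : PreMatching A B} (hT : 1 ≤ E.T)
    (hm : IsMatching E m) {C : Agent A B → Set (PreMatching A B)} {b : B}
    (hC : C (Sum.inr b) ⊆ {m | IsMatching E m})
    (hmem : m.mB 0 b = none → m ∈ C (Sum.inr b)) :
    indV P (wB P E 0 C) b (m.mB 0 b) ≤ Vpay P E m 0 b := by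
  rcases h : m.mB 0 b with _ | a
  · exact csInf_le ((finite_Vpay_image P E hT 0 b).subset (Set.image_mono hC)).bddBelow
      ⟨m, hmem h, rfl⟩
  · exact (Vpay_zero_of_matched P hT hm h).ge

/-- The worst conjectured payoff is attained. -/
theorem exists_Upay_eq_wA (P : Pref A B) {E : Economy A B} (hT : 1 ≤ E.T) (t : ℕ)
    {C : Agent A B → Set (PreMatching A B)} {a : A}
    (hC : C (Sum.inl a) ⊆ {m | IsMatching E m}) (hne : (C (Sum.inl a)).Nonempty) :
    ∃ m' ∈ C (Sum.inl a), Upay P E m' t a = wA P E t C a :=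
  (hne.image _).csInf_mem ((finite_Upay_image P E hT t a).subset (Set.image_mono hC))

theorem exists_Vpay_eq_wB (P : Pref A B) {E : Economy A B} (hT : 1 ≤ E.T) (t : ℕ)
    {C : Agent A B → Set (PreMatching A B)} {b : B}
    (hC : C (Sum.inr b) ⊆ {m | IsMatching E m}) (hne : (C (Sum.inr b)).Nonempty) :
    ∃ m' ∈ C (Sum.inr b), Vpay P E m' t b = wB P E t C b :=
  (hne.image _).csInf_mem ((finite_Vpay_image P E hT t b).subset (Set.image_mono hC))

/-- Theorem 1: if the `Φ`-solution correspondence on continuation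
economies is nonempty-valued, `m*` is a candidate matching (period-1 matching stable in
the induced one-period economy, continuation a `Φ`-solution of the continuation
economy), and `m*` is a conjecture of every period-1 agent left unmatched under `m*`,
then `m*` is a `Φ`-solution of `E`. -/
theorem statement2
    (A B : Type) [DecidableEq A] [DecidableEq B]
    (P : Pref A B) (hP : P.Valid)
    (E : Economy A B) (hE : E.Valid) (hT : 1 ≤ E.T)
    (φ : ConjFam A B) (hφ : ConjFam.Valid E φ)
    (hne : ∀ m₁ : PreMatching A B, IsMatching E m₁ →
      (SolSet P (contEconomy E m₁ 1) (contConj E φ m₁ 1)).Nonempty)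
    (mstar : PreMatching A B) (hm : IsMatching E mstar)
    (hstab : StableInduced P E mstar 0 (φ 0 mstar) mstar)
    (hcont : restrictM mstar 1 ∈ SolSet P (contEconomy E mstar 1) (contConj E φ mstar 1))
    (hcc : ∀ k : Agent A B, inPeriodOne E k → unmatchedAt mstar 0 k →
      mstar ∈ φ 0 mstar k) :
    IsSolution P E φ mstar := by
  have hC : ∀ t k, φ t mstar k ⊆ {m | IsMatching E m} := fun t k m' h => (hφ.1 t mstar k h).1
  refine ⟨hm, fun t ht => ?_⟩
  rcases Nat.eq_zero_or_pos t with rfl | hpos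
  · obtain ⟨-, -, hA, hB, hblock⟩ := hstab
    have hA₀ : ∀ a ∈ availA E mstar 0, a ∈ E.arrA 0 := by simp [availA, arrAUpTo]
    have hB₀ : ∀ b ∈ availB E mstar 0, b ∈ E.arrB 0 := by simp [availB, arrBUpTo]
    refine ⟨fun a ha => ?_, fun b hb => ?_, fun a ha b hb => ?_⟩
    · rcases h : mstar.mA 0 a with _ | b
      · exact ⟨mstar, hcc (Sum.inl a) (hA₀ a ha) h, le_rfl⟩
      · obtain ⟨m', hm', heq⟩ := exists_Upay_eq_wA P hT 0 (C := φ 0 mstar) (hC 0 _)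
          (hφ.2.2 0 mstar (Sum.inl a) ht hm ha)
        exact ⟨m', hm', by
          rw [heq, Upay_zero_of_matched P hT hm h]
          exact hA a ha b h⟩
    · rcases h : mstar.mB 0 b with _ | a
      · exact ⟨mstar, hcc (Sum.inr b) (hB₀ b hb) h, le_rfl⟩
      · obtain ⟨m', hm', heq⟩ := exists_Vpay_eq_wB P hT 0 (C := φ 0 mstar) (hC 0 _)
          (hφ.2.2 0 mstar (Sum.inr b) ht hm hb)
        exact ⟨m', hm', by
          rw [heq, Vpay_zero_of_matched P hT hm h]
          exact hB b hb a h⟩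
    · rintro ⟨hu, hv⟩
      exact hblock a ha b hb
        ⟨(indU_le_Upay P hT hm (hC 0 _)
            (hcc (Sum.inl a) (hA₀ a ha))).trans_lt hu,
          (indV_le_Vpay P hT hm (hC 0 _)
            (hcc (Sum.inr b) (hB₀ b hb))).trans_lt hv⟩
  · obtain ⟨s, rfl⟩ := Nat.exists_eq_add_of_le hpos
    have hs : s < (contEconomy E mstar 1).T := by
      change s < E.T - 1
      omega
    obtain ⟨hA, hB, hblock⟩ := hcont.2 s hs
    have hconj : ∀ k, φ (1 + s) (splice mstar (restrictM mstar 1) 1) k = φ (1 + s) mstar k :=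
      fun k => hφ.2.1 _ _ _ k (agreeUpTo_splice_restrictM hm ht.le)
    have hUnA : ∀ a ∈ availA E mstar (1 + s), mstar.mA 0 a = none :=
      fun a ha => (Finset.mem_filter.1 ha).2 0 (by omega)
    have hUnB : ∀ b ∈ availB E mstar (1 + s), mstar.mB 0 b = none :=
      fun b hb => (Finset.mem_filter.1 hb).2 0 (by omega)
    refine ⟨fun a ha => ?_, fun b hb => ?_, fun a ha b hb => ?_⟩
    · obtain ⟨_, ⟨m', hm', rfl⟩, hle⟩ := hA a (mem_availA_contEconomy ha)
      rw [hconj] at hm'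
      rw [Upay_restrictM P E mstar m' ht ((hφ.1 _ _ _ hm').2.2 0 (Nat.zero_le _)),
        Upay_restrictM P E mstar mstar ht (hUnA a ha)] at hle
      exact ⟨m', hm', hle⟩
    · obtain ⟨_, ⟨m', hm', rfl⟩, hle⟩ := hB b (mem_availB_contEconomy hb)
      rw [hconj] at hm'
      rw [Vpay_restrictM P E mstar m' ht ((hφ.1 _ _ _ hm').2.2 0 (Nat.zero_le _)),
        Vpay_restrictM P E mstar mstar ht (hUnB b hb)] at hle
      exact ⟨m', hm', hle⟩
    · have h := hblock a (mem_availA_contEconomy ha) b (mem_availB_contEconomy hb)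
      rwa [Upay_restrictM P E mstar mstar ht (hUnA a ha),
        Vpay_restrictM P E mstar mstar ht (hUnB b hb)] at h

end

end DynMatch
end

section
/- In the setting of the decreasing recursion φ_0(∅,k) = M_T(∅,k), φ_n(∅,k) = {m̄ ∈ M_T(∅,k) : m̄_1 stable among those who match in period 1 relative to φ_{n−1}(∅,·), and continuation in D̂S_{T−1}(E_2^T(m̄_1))} (with D̂S_{T−1} nonempty-valued), there exists a finite N̄ such that φ_{N̄}(∅,k) = φ_{N̄+1}(∅,k) for all k ∈ A_1∪B_1; moreover, for all N ≥ N̄ and all k, φ_N(∅,k) = φ_{N̄}(∅,k), so the limit φ_∞(∅,k) = lim_{n→∞} φ_n(∅,k) is well defined, and φ_∞ satisfies the fixed-point identity φ_∞(∅,k) = {m̄ ∈ M_T(∅,k) : m̄_1 is stable among those who match in period 1 relative to φ_∞(∅,·), and the restriction of (m̄_s)_{s=2}^T to E_2^T(m̄_1) lies in D̂S_{T−1}(E_2^T(m̄_1))} for every k. -/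
/-!
A framework for two-sided, one-to-one, irreversible dynamic matching markets
with conjectures, following Doval's "A framework for (dynamic) stability".

Periods are indexed `0, …, T-1` (the paper's periods `1, …, T`).
-/

namespace DynMatch

open Classical

noncomputable section

variable {A B : Type} [DecidableEq A] [DecidableEq B]

/-- Delay a continuation matching by one period, leaving everyone unmatched in period `0`. -/
def delayM (m : PreMatching A B) : PreMatching A B where
  mA := fun s a => if s = 0 then none else m.mA (s - 1) a
  mB := fun s b => if s = 0 then none else m.mB (s - 1) b

lemma restrictM_delayM (m : PreMatching A B) : restrictM (delayM m) 1 = m := by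
  cases m
  simp [restrictM, delayM]

lemma contEconomy_valid (E : Economy A B) (hE : E.Valid) (hT : 2 ≤ E.T)
    (m : PreMatching A B) : (contEconomy E m 1).Valid := by
  obtain ⟨-, hA, hB, hA', hB'⟩ := hE
  have keyA : ∀ s, s ≠ 0 → Disjoint (availA E m 1) (E.arrA (1 + s)) := by
    intro s hs
    refine Finset.disjoint_of_subset_left (Finset.filter_subset _ _) ?_
    rw [arrAUpTo, Finset.disjoint_biUnion_left]
    intro i hi
    exact hA _ _ (by simp at hi; omega)
  have keyB : ∀ s, s ≠ 0 → Disjoint (availB E m 1) (E.arrB (1 + s)) := by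
    intro s hs
    refine Finset.disjoint_of_subset_left (Finset.filter_subset _ _) ?_
    rw [arrBUpTo, Finset.disjoint_biUnion_left]
    intro i hi
    exact hB _ _ (by simp at hi; omega)
  refine ⟨by simp only [contEconomy]; omega, fun s t hst => ?_, fun s t hst => ?_,
    fun s hs => ?_, fun s hs => ?_⟩
  · by_cases hs : s = 0 <;> by_cases ht : t = 0 <;>
      simp only [contEconomy, hs, ht, if_true, if_false]
    · omega
    · exact keyA t ht
    · exact (keyA s hs).symm
    · exact hA _ _ (by omega)
  · by_cases hs : s = 0 <;> by_cases ht : t = 0 <;>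
      simp only [contEconomy, hs, ht, if_true, if_false]
    · omega
    · exact keyB t ht
    · exact (keyB s hs).symm
    · exact hB _ _ (by omega)
  · simp only [contEconomy] at hs ⊢
    rw [if_neg (by omega)]
    exact hA' _ (by omega)
  · simp only [contEconomy] at hs ⊢
    rw [if_neg (by omega)]
    exact hB' _ (by omega)

lemma arrAUpTo_contEconomy_subset (E : Economy A B) (m : PreMatching A B) (t : ℕ) :
    arrAUpTo (contEconomy E m 1) t ⊆ arrAUpTo E (t + 1) := by
  intro a ha
  simp only [arrAUpTo, Finset.mem_biUnion, Finset.mem_range, contEconomy] at ha ⊢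
  obtain ⟨s, hs, ha⟩ := ha
  split_ifs at ha with h
  · simp only [availA, arrAUpTo, Finset.mem_filter, Finset.mem_biUnion, Finset.mem_range] at ha
    obtain ⟨⟨i, hi, ha⟩, -⟩ := ha
    exact ⟨i, by omega, ha⟩
  · exact ⟨1 + s, by omega, ha⟩

lemma arrBUpTo_contEconomy_subset (E : Economy A B) (m : PreMatching A B) (t : ℕ) :
    arrBUpTo (contEconomy E m 1) t ⊆ arrBUpTo E (t + 1) := by
  intro b hb
  simp only [arrBUpTo, Finset.mem_biUnion, Finset.mem_range, contEconomy] at hb ⊢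
  obtain ⟨s, hs, hb⟩ := hb
  split_ifs at hb with h
  · simp only [availB, arrBUpTo, Finset.mem_filter, Finset.mem_biUnion, Finset.mem_range] at hb
    obtain ⟨⟨i, hi, hb⟩, -⟩ := hb
    exact ⟨i, by omega, hb⟩
  · exact ⟨1 + s, by omega, hb⟩

lemma isMatching_delayM (E : Economy A B) (m₀ m : PreMatching A B)
    (h : IsMatching (contEconomy E m₀ 1) m) : IsMatching E (delayM m) := by
  obtain ⟨h1, h2, h3, h4, h5⟩ := h
  have hT : (contEconomy E m₀ 1).T = E.T - 1 := rfl
  rw [hT] at h1 h2 h3 h4 h5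
  refine ⟨?_, ?_, ?_, ?_, ?_⟩
  · rintro (_ | t) a b ht
    · simp [delayM]
    · simpa [delayM] using h1 t a b (by omega)
  · rintro (_ | t) a ht
    · simp [delayM]
    · simp only [delayM, Nat.add_one_ne_zero, if_false, Nat.add_sub_cancel]
      exact fun h => arrAUpTo_contEconomy_subset E m₀ t (h2 t a (by omega) h)
  · rintro (_ | t) a b ht
    · simp [delayM]
    · simp only [delayM, Nat.add_one_ne_zero, if_false, Nat.add_sub_cancel]
      exact fun h => arrBUpTo_contEconomy_subset E m₀ t (h3 t a b (by omega) h)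
  · rintro (_ | t) (_ | s) a hts hs
    · simp
    · simp [delayM]
    · omega
    · simp only [delayM, Nat.add_one_ne_zero, if_false, Nat.add_sub_cancel]
      exact h4 t s a (by omega) (by omega)
  · rintro (_ | t) (_ | s) b hts hs
    · simp
    · simp [delayM]
    · omega
    · simp only [delayM, Nat.add_one_ne_zero, if_false, Nat.add_sub_cancel]
      exact h5 t s b (by omega) (by omega)

lemma contEconomy_delayM (E : Economy A B) (m : PreMatching A B) :
    contEconomy E (delayM m) 1 = contEconomy E emptyM 1 := by
  simp [contEconomy, availA, availB, delayM, emptyM]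

lemma IsCVRFamily.isMatching {P : Pref A B} {DS : Economy A B → Set (PreMatching A B)}
    (hDS : IsCVRFamily P DS) {E : Economy A B} (hE : 0 < E.T) {m : PreMatching A B}
    (hm : m ∈ DS E) : IsMatching E m := by
  by_cases h : E.T = 1
  · rw [hDS.2.1 E h] at hm
    exact hm.1
  · rw [hDS.2.2 E (by omega)] at hm
    exact hm.1

/-- Leaving every agent unmatched in period `0` is always conjectured. -/
lemma cvrIter_nonempty {P : Pref A B} {DS : Economy A B → Set (PreMatching A B)}
    (hDS : IsCVRFamily P DS) {E : Economy A B} (hE : E.Valid) (hT : 2 ≤ E.T)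
    (hne : ∀ E' : Economy A B, E'.Valid → E'.T + 1 = E.T → (DS E').Nonempty)
    (n : ℕ) (k : Agent A B) : (cvrIter P E DS 0 emptyM n k).Nonempty := by
  have hv := contEconomy_valid E hE hT emptyM
  obtain ⟨m, hm⟩ := hne _ hv (by simp only [contEconomy]; omega)
  have hmem : delayM m ∈ MSet E emptyM 0 k := by
    refine ⟨isMatching_delayM E emptyM m (hDS.isMatching hv.1 hm), ?_, ?_⟩
    · simp [agreeUpTo]
    · cases k <;> simp [unmatchedThrough, delayM]
  refine ⟨delayM m, ?_⟩
  cases n with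
  | zero => exact hmem
  | succ n =>
    refine ⟨hmem, by simp [StableAmongMatched, delayM], ?_⟩
    rw [zero_add, restrictM_delayM, contEconomy_delayM]
    exact hm

lemma finite_Upay (P : Pref A B) (E : Economy A B) (hT : 0 < E.T) (t : ℕ) (a : A) :
    ((fun m => Upay P E m t a) '' {m | IsMatching E m}).Finite := by
  refine (((Finset.finite_toSet (arrBUpTo E (E.T - 1) ×ˢ Finset.range (E.T + 1))).image
    fun p : B × ℕ => P.dA a ^ (p.2 - t) * P.u a p.1).insert 0).subset ?_
  rintro _ ⟨m, hm, rfl⟩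
  simp only [Upay]
  cases h : m.mA (E.T - 1) a with
  | none => exact Or.inl rfl
  | some b =>
    refine Or.inr ⟨(b, matchTimeA E m t a), ?_, rfl⟩
    simp only [Finset.coe_product, Set.mem_prod, Finset.mem_coe, Finset.mem_range]
    exact ⟨hm.2.2.1 _ a b (by omega) h, Nat.lt_succ_of_le (min_le_right _ _)⟩

lemma finite_Vpay (P : Pref A B) (E : Economy A B) (hT : 0 < E.T) (t : ℕ) (b : B) :
    ((fun m => Vpay P E m t b) '' {m | IsMatching E m}).Finite := by
  refine (((Finset.finite_toSet (arrAUpTo E (E.T - 1) ×ˢ Finset.range (E.T + 1))).image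
    fun p : A × ℕ => P.dB b ^ (p.2 - t) * P.v p.1 b).insert 0).subset ?_
  rintro _ ⟨m, hm, rfl⟩
  simp only [Vpay]
  cases h : m.mB (E.T - 1) b with
  | none => exact Or.inl rfl
  | some a =>
    refine Or.inr ⟨(a, matchTimeB E m t b), ?_, rfl⟩
    simp only [Finset.coe_product, Set.mem_prod, Finset.mem_coe, Finset.mem_range]
    have h' := (hm.1 (E.T - 1) a b (by omega)).2 h
    exact ⟨hm.2.1 _ a (by omega) (by simp [h']), Nat.lt_succ_of_le (min_le_right _ _)⟩

lemma cvrIter_subset_isMatching (P : Pref A B) (E : Economy A B)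
    (DS : Economy A B → Set (PreMatching A B)) (t : ℕ) (m : PreMatching A B) (n : ℕ)
    (k : Agent A B) : cvrIter P E DS t m n k ⊆ {m | IsMatching E m} := by
  cases n with
  | zero => exact fun _ h => h.1
  | succ n => exact fun _ h => h.1.1

lemma finite_range_of_sInf_image {α : Type*} {f : α → ℝ} {S : Set α} (hS : (f '' S).Finite)
    {φ : ℕ → Set α} (hφ : ∀ n, φ n ⊆ S) : (Set.range fun n => sInf (f '' φ n)).Finite := by
  refine (hS.finite_subsets.image sInf).subset ?_
  rintro _ ⟨n, rfl⟩
  exact ⟨_, Set.image_mono (hφ n), rfl⟩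

lemma eventually_const_of_monotone_of_finite_range {f : ℕ → ℝ} (hf : Monotone f)
    (hfin : (Set.range f).Finite) : ∃ c, ∀ᶠ n in Filter.atTop, f n = c := by
  obtain ⟨_, ⟨N, rfl⟩, hN⟩ := Set.exists_max_image _ id hfin (Set.range_nonempty f)
  exact ⟨f N, Filter.eventually_atTop.2 ⟨N, fun n hn =>
    le_antisymm (hN _ ⟨n, rfl⟩) (hf hn)⟩⟩

lemma StableAmongMatched.of_le {P : Pref A B} {E : Economy A B} {m mbar : PreMatching A B} {t : ℕ}
    {C D : Agent A B → Set (PreMatching A B)} (h : StableAmongMatched P E m t C mbar)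
    (hA : ∀ a ∈ availA E m t, wA P E t D a ≤ wA P E t C a)
    (hB : ∀ b ∈ availB E m t, wB P E t D b ≤ wB P E t C b) :
    StableAmongMatched P E m t D mbar :=
  ⟨fun a ha b hab => (hA a ha).trans (h.1 a ha b hab),
    fun b hb a hab => (hB b hb).trans (h.2.1 b hb a hab), h.2.2⟩

lemma wA_mono {P : Pref A B} {E : Economy A B} (hT : 0 < E.T) {t : ℕ}
    {C D : Agent A B → Set (PreMatching A B)} {a : A} (hDC : D (Sum.inl a) ⊆ C (Sum.inl a))
    (hD : (D (Sum.inl a)).Nonempty) (hC : C (Sum.inl a) ⊆ {m | IsMatching E m}) :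
    wA P E t C a ≤ wA P E t D a :=
  csInf_le_csInf ((finite_Upay P E hT t a).subset (Set.image_mono hC)).bddBelow
    (hD.image _) (Set.image_mono hDC)

lemma wB_mono {P : Pref A B} {E : Economy A B} (hT : 0 < E.T) {t : ℕ}
    {C D : Agent A B → Set (PreMatching A B)} {b : B} (hDC : D (Sum.inr b) ⊆ C (Sum.inr b))
    (hD : (D (Sum.inr b)).Nonempty) (hC : C (Sum.inr b) ⊆ {m | IsMatching E m}) :
    wB P E t C b ≤ wB P E t D b :=
  csInf_le_csInf ((finite_Vpay P E hT t b).subset (Set.image_mono hC)).bddBelow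
    (hD.image _) (Set.image_mono hDC)

lemma cvrIter_antitone {P : Pref A B} {E : Economy A B}
    {DS : Economy A B → Set (PreMatching A B)} {t : ℕ} {m : PreMatching A B} (hT : 0 < E.T)
    (hne : ∀ n k, (cvrIter P E DS t m n k).Nonempty) : Antitone (cvrIter P E DS t m) := by
  refine antitone_nat_of_succ_le fun n => ?_
  induction n with
  | zero => exact fun k _ h => h.1
  | succ n ih =>
    refine fun k mbar h => ⟨h.1, h.2.1.of_le (fun a _ => ?_) (fun b _ => ?_), h.2.2⟩
    · exact wA_mono hT (ih _) (hne _ _) (cvrIter_subset_isMatching ..)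
    · exact wB_mono hT (ih _) (hne _ _) (cvrIter_subset_isMatching ..)

lemma cvrIter_stabilizes {P : Pref A B} {E : Economy A B}
    {DS : Economy A B → Set (PreMatching A B)} {t : ℕ} {m : PreMatching A B} (hT : 0 < E.T)
    (hne : ∀ n k, (cvrIter P E DS t m n k).Nonempty) :
    ∃ N, ∀ n, N ≤ n → cvrIter P E DS t m n = cvrIter P E DS t m N := by
  have hanti := cvrIter_antitone hT hne
  have hA : ∀ a, ∃ c, ∀ᶠ n in Filter.atTop, wA P E t (cvrIter P E DS t m n) a = c := fun a =>
    eventually_const_of_monotone_of_finite_range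
      (fun i j hij => wA_mono hT (hanti hij _) (hne _ _) (cvrIter_subset_isMatching ..))
      (finite_range_of_sInf_image (finite_Upay P E hT t a)
        fun n => cvrIter_subset_isMatching P E DS t m n (Sum.inl a))
  have hB : ∀ b, ∃ c, ∀ᶠ n in Filter.atTop, wB P E t (cvrIter P E DS t m n) b = c := fun b =>
    eventually_const_of_monotone_of_finite_range
      (fun i j hij => wB_mono hT (hanti hij _) (hne _ _) (cvrIter_subset_isMatching ..))
      (finite_range_of_sInf_image (finite_Vpay P E hT t b)
        fun n => cvrIter_subset_isMatching P E DS t m n (Sum.inr b))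
  choose cA hA using hA
  choose cB hB using hB
  have hA' := (Filter.eventually_all_finset (availA E m t)).2 fun a _ => hA a
  have hB' := (Filter.eventually_all_finset (availB E m t)).2 fun b _ => hB b
  obtain ⟨N, hN⟩ := Filter.eventually_atTop.1 (hA'.and hB')
  refine ⟨N + 1, fun n hn => le_antisymm (hanti hn) ?_⟩
  obtain ⟨n, rfl⟩ : ∃ j, n = j + 1 := ⟨n - 1, by omega⟩
  have hn' := hN n (by omega)
  have hN' := hN N le_rfl
  exact fun k mbar h => ⟨h.1, h.2.1.of_le
    (fun a ha => ((hn'.1 a ha).trans (hN'.1 a ha).symm).le)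
    (fun b hb => ((hn'.2 b hb).trans (hN'.2 b hb).symm).le), h.2.2⟩

/-- the decreasing recursion defining the period-1 CVR conjectures
stabilizes after finitely many steps, so its limit `φ_∞ = ⋂_n φ_n` is well defined, and
`φ_∞` satisfies the fixed-point identity of the CVR conjectures. -/
theorem statement7
    (A B : Type) [DecidableEq A] [DecidableEq B]
    (P : Pref A B) (hP : P.Valid)
    (DS : Economy A B → Set (PreMatching A B)) (hDS : IsCVRFamily P DS)
    (E : Economy A B) (hE : E.Valid) (hT : 2 ≤ E.T)
    (hne : ∀ E' : Economy A B, E'.Valid → E'.T + 1 = E.T → (DS E').Nonempty) :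
    (∃ N : ℕ,
      (∀ k : Agent A B, inPeriodOne E k →
        cvrIter P E DS 0 emptyM N k = cvrIter P E DS 0 emptyM (N+1) k) ∧
      (∀ N' : ℕ, N ≤ N' → ∀ k : Agent A B, inPeriodOne E k →
        cvrIter P E DS 0 emptyM N' k = cvrIter P E DS 0 emptyM N k)) ∧
    (∀ k : Agent A B, inPeriodOne E k →
      (⋂ n, cvrIter P E DS 0 emptyM n k) =
        {mbar | mbar ∈ MSet E emptyM 0 k ∧
          StableAmongMatched P E emptyM 0
            (fun k' => ⋂ n, cvrIter P E DS 0 emptyM n k') mbar ∧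
          restrictM mbar 1 ∈ DS (contEconomy E mbar 1)}) := by
  have hnon := fun n k => cvrIter_nonempty hDS hE hT hne n k
  obtain ⟨N, hN⟩ := cvrIter_stabilizes (by omega) hnon
  have hlim : (fun k => ⋂ n, cvrIter P E DS 0 emptyM n k) = cvrIter P E DS 0 emptyM N := by
    funext k
    refine subset_antisymm (Set.iInter_subset _ N) (Set.subset_iInter fun n => ?_)
    rcases le_total N n with h | h
    · rw [hN n h]
    · exact cvrIter_antitone (by omega) hnon h k
  refine ⟨⟨N, fun k _ => by rw [hN (N + 1) (by omega)], fun n hn k _ => by rw [hN n hn]⟩,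
    fun k _ => ?_⟩
  rw [hlim, congrFun hlim k]
  exact congrFun (hN (N + 1) (by omega)).symm k

end

end DynMatch
end
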